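/- arXiv:1404.3692 — 6 statements merged into one kernel-verified Lean document; each statement's English description precedes it below -/
import Mathlib

section
/- (Discrete comparison principle.) Let u be a subsolution and v a supersolution of the discrete eikonal equation |Du|ₕ = f on V₀. If u(x) ≤ v(x) for every x ∈ Γ, then u(x) ≤ v(x) for every x ∈ V. -/
open Finset

variable {V : Type*}

/-- The discrete gradient `|Du(x)|ₕ = max_{y ∼ x} (u(x) − u(y))/h`
(as a supremum over the neighbours of `x`). -/
noncomputable def discGrad (G : SimpleGraph V) (h : ℝ) (u : V → ℝ) (x : V) : ℝ :=
  sSup ((fun y => (u x - u y) / h) '' {y | G.Adj x y})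

theorem discGrad_le_iff [Finite V] {G : SimpleGraph V} {h : ℝ} {u : V → ℝ} {x : V} {c : ℝ}
    (hx : ∃ y, G.Adj x y) :
    discGrad G h u x ≤ c ↔ ∀ y, G.Adj x y → (u x - u y) / h ≤ c := by
  obtain ⟨z, hz⟩ := hx
  have hne : ((fun y => (u x - u y) / h) '' {y | G.Adj x y}).Nonempty := ⟨_, z, hz, rfl⟩
  rw [discGrad, csSup_le_iff (Set.toFinite _).bddAbove hne, Set.forall_mem_image]
  rfl

theorem exists_adj_eq_discGrad [Finite V] (G : SimpleGraph V) (h : ℝ) (u : V → ℝ) {x : V}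
    (hx : ∃ y, G.Adj x y) : ∃ y, G.Adj x y ∧ (u x - u y) / h = discGrad G h u x := by
  obtain ⟨z, hz⟩ := hx
  exact Set.Nonempty.csSup_mem (s := (fun y => (u x - u y) / h) '' {y | G.Adj x y})
    ⟨_, z, hz, rfl⟩ (Set.toFinite _)

/-- Discrete comparison principle: if `u` is a subsolution and `v` a
supersolution of `|Du|ₕ = f` on the interior `V₀ = V \ Γ` and `u ≤ v` on the
boundary `Γ`, then `u ≤ v` everywhere. -/
theorem discrete_comparison [Fintype V] [Nonempty V]
    (G : SimpleGraph V) (Γ : Finset V) (hΓ : Γ.Nonempty)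
    (hnb : ∀ x ∉ Γ, ∃ y, G.Adj x y)
    (h : ℝ) (hh : 0 < h)
    (f : V → ℝ) (hf : ∀ x ∉ Γ, 0 < f x)
    (u v : V → ℝ)
    (hu : ∀ x ∉ Γ, discGrad G h u x ≤ f x)
    (hv : ∀ x ∉ Γ, f x ≤ discGrad G h v x)
    (hbd : ∀ x ∈ Γ, u x ≤ v x) :
    ∀ x : V, u x ≤ v x := by
  intro x
  induction x using (Finite.wellFounded_of_trans_of_irrefl
    (fun a b : V => v a < v b)).induction with
  | _ x ih =>
    by_cases hx : x ∈ Γ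
    · exact hbd x hx
    obtain ⟨y, hxy, hy⟩ := exists_adj_eq_discGrad G h v (hnb x hx)
    have hvy : f x ≤ (v x - v y) / h := hy ▸ hv x hx
    have hlt : v y < v x := by
      have := (div_pos_iff_of_pos_right hh).1 ((hf x hx).trans_le hvy)
      linarith
    have huy := (discGrad_le_iff (hnb x hx)).1 (hu x hx) y hxy
    have hle := (div_le_div_iff_of_pos_right hh).1 (huy.trans hvy)
    linarith [ih y hlt]
end

section
/- (Uniqueness for the discrete Dirichlet problem.) If u and v are both solutions of the discrete eikonal equation |Du|ₕ = f on V₀ and u(x) = v(x) for every x ∈ Γ, then u = v on all of V. -/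
open Finset

variable {V : Type*}

theorem discGrad_finite_image [Finite V] (G : SimpleGraph V) (h : ℝ) (u : V → ℝ) (x : V) :
    ((fun y => (u x - u y) / h) '' {y | G.Adj x y}).Finite :=
  (Set.toFinite _).image _

theorem div_le_discGrad [Finite V] {G : SimpleGraph V} (h : ℝ) (u : V → ℝ) {x y : V}
    (hxy : G.Adj x y) : (u x - u y) / h ≤ discGrad G h u x :=
  le_csSup (discGrad_finite_image G h u x).bddAbove ⟨y, hxy, rfl⟩

theorem exists_adj_div_eq_discGrad [Finite V] {G : SimpleGraph V} (h : ℝ) (u : V → ℝ) {x : V}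
    (hx : ∃ y, G.Adj x y) : ∃ y, G.Adj x y ∧ (u x - u y) / h = discGrad G h u x :=
  (Set.Nonempty.image _ hx).csSup_mem (discGrad_finite_image G h u x)

/-- Comparison principle: a subsolution lying below a supersolution on the boundary lies below it
everywhere. -/
theorem le_of_discGrad_le_of_le_discGrad [Finite V] {G : SimpleGraph V} {Γ : Finset V}
    (hnb : ∀ x ∉ Γ, ∃ y, G.Adj x y) {h : ℝ} (hh : 0 < h) {f : V → ℝ} (hf : ∀ x ∉ Γ, 0 < f x)
    {u v : V → ℝ} (hu : ∀ x ∉ Γ, discGrad G h u x ≤ f x) (hv : ∀ x ∉ Γ, f x ≤ discGrad G h v x)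
    (hbd : ∀ x ∈ Γ, u x ≤ v x) : u ≤ v := by
  let _ : Preorder V := Preorder.lift v
  intro x
  induction x using WellFoundedLT.induction with
  | ind x ih =>
    by_cases hx : x ∈ Γ
    · exact hbd x hx
    obtain ⟨y, hxy, hy⟩ := exists_adj_div_eq_discGrad h v (hnb x hx)
    have hle : (u x - u y) / h ≤ (v x - v y) / h :=
      (div_le_discGrad h u hxy).trans ((hu x hx).trans ((hv x hx).trans hy.ge))
    have hpos : 0 < (v x - v y) / h := (hf x hx).trans_le ((hv x hx).trans hy.ge)
    have hlt : v y < v x := sub_pos.1 ((div_pos_iff_of_pos_right hh).1 hpos)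
    have huv : u y ≤ v y := ih y hlt
    linarith [(div_le_div_iff_of_pos_right hh).1 hle]

/-- Uniqueness for the discrete Dirichlet problem: two solutions of
`|Du|ₕ = f` on `V₀` which agree on the boundary `Γ` agree everywhere. -/
theorem discrete_uniqueness [Fintype V] [Nonempty V]
    (G : SimpleGraph V) (Γ : Finset V) (hΓ : Γ.Nonempty)
    (hnb : ∀ x ∉ Γ, ∃ y, G.Adj x y)
    (h : ℝ) (hh : 0 < h)
    (f : V → ℝ) (hf : ∀ x ∉ Γ, 0 < f x)
    (u v : V → ℝ)
    (hu : ∀ x ∉ Γ, discGrad G h u x = f x)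
    (hv : ∀ x ∉ Γ, discGrad G h v x = f x)
    (hbd : ∀ x ∈ Γ, u x = v x) :
    u = v := by
  apply le_antisymm
  · exact le_of_discGrad_le_of_le_discGrad hnb hh hf (fun x hx => (hu x hx).le)
      (fun x hx => (hv x hx).ge) (fun x hx => (hbd x hx).le)
  · exact le_of_discGrad_le_of_le_discGrad hnb hh hf (fun x hx => (hv x hx).le)
      (fun x hx => (hu x hx).ge) (fun x hx => (hbd x hx).ge)
end

section
/- (Existence via the value function.) Assume in addition f(x) ≥ 0 for all x ∈ V and that every vertex of V can be joined to some vertex of Γ by a path in G. Let g : Γ → ℝ and define U(x) := inf { h·Σ_{k=0}^{N−1} f(x_k) + g(y) }, the infimum taken over all y ∈ Γ and all paths x₀ = x, x₁, …, x_N = y in G. Then U is a solution of the discrete eikonal equation |DU|ₕ = f on V₀, i.e. max_{y ∼ x} (U(x) − U(y))/h = f(x) for every x ∈ V₀. -/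
open Finset

variable {V : Type*}

/-- A path of length `N` in the graph `G` from `x` to `y`. -/
def IsGraphPath (G : SimpleGraph V) (N : ℕ) (p : ℕ → V) (x y : V) : Prop :=
  p 0 = x ∧ p N = y ∧ ∀ i < N, G.Adj (p i) (p (i + 1))

/-- The cost of a path of length `N`: `h·Σ_{k=0}^{N−1} f(x_k) + g(x_N)`. -/
noncomputable def pathCost (h : ℝ) (f g : V → ℝ) (N : ℕ) (p : ℕ → V) : ℝ :=
  h * ∑ k ∈ Finset.range N, f (p k) + g (p N)

/-- The value function `U(x)`: infimum of the path costs over all boundary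
vertices `y ∈ Γ` and all paths from `x` to `y`. -/
noncomputable def valueFun (G : SimpleGraph V) (Γ : Finset V) (h : ℝ) (f g : V → ℝ)
    (x : V) : ℝ :=
  sInf {c : ℝ | ∃ y ∈ Γ, ∃ N : ℕ, ∃ p : ℕ → V,
    IsGraphPath G N p x y ∧ c = pathCost h f g N p}

/-- Prepending a vertex to a path. -/
theorem IsGraphPath.cons {G : SimpleGraph V} {N : ℕ} {p : ℕ → V} {x y z : V}
    (hxy : G.Adj x y) (hp : IsGraphPath G N p y z) :
    IsGraphPath G (N + 1) (fun n => Nat.casesOn n x p) x z := by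
  refine ⟨rfl, hp.2.1, fun i hi => ?_⟩
  cases i with
  | zero => simpa [hp.1] using hxy
  | succ i => exact hp.2.2 i (by omega)

/-- Removing the initial vertex of a path. -/
theorem IsGraphPath.tail {G : SimpleGraph V} {N : ℕ} {p : ℕ → V} {x z : V}
    (hp : IsGraphPath G (N + 1) p x z) :
    IsGraphPath G N (fun n => p (n + 1)) (p 1) z :=
  ⟨rfl, hp.2.1, fun i hi => hp.2.2 (i + 1) (by omega)⟩

theorem pathCost_succ (h : ℝ) (f g : V → ℝ) (N : ℕ) (p : ℕ → V) :
    pathCost h f g (N + 1) p = h * f (p 0) + pathCost h f g N (fun n => p (n + 1)) := by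
  simp only [pathCost, Finset.sum_range_succ']
  ring

theorem valueFun_le_pathCost {G : SimpleGraph V} {Γ : Finset V} {h : ℝ} (hh : 0 ≤ h)
    {f : V → ℝ} (hf : ∀ x, 0 ≤ f x) (g : V → ℝ) {N : ℕ} {p : ℕ → V} {x y : V}
    (hy : y ∈ Γ) (hp : IsGraphPath G N p x y) :
    valueFun G Γ h f g x ≤ pathCost h f g N p := by
  refine csInf_le ?_ ⟨y, hy, N, p, hp, rfl⟩
  obtain ⟨m, hm⟩ := (Γ.finite_toSet.image g).bddBelow
  refine ⟨m, ?_⟩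
  rintro c ⟨z, hz, M, q, hq, rfl⟩
  have hmz : m ≤ g (q M) := hm ⟨z, hz, by rw [hq.2.1]⟩
  have hsum : 0 ≤ h * ∑ k ∈ Finset.range M, f (q k) :=
    mul_nonneg hh (Finset.sum_nonneg fun k _ => hf (q k))
  unfold pathCost
  linarith

theorem le_valueFun {G : SimpleGraph V} {Γ : Finset V} {h : ℝ} {f g : V → ℝ} {x : V} {c : ℝ}
    (hreach : ∃ y ∈ Γ, ∃ N : ℕ, ∃ p : ℕ → V, IsGraphPath G N p x y)
    (hc : ∀ y ∈ Γ, ∀ N p, IsGraphPath G N p x y → c ≤ pathCost h f g N p) :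
    c ≤ valueFun G Γ h f g x := by
  obtain ⟨y, hy, N, p, hp⟩ := hreach
  refine le_csInf ⟨_, y, hy, N, p, hp, rfl⟩ ?_
  rintro _ ⟨z, hz, M, q, hq, rfl⟩
  exact hc z hz M q hq

theorem valueFun_le_add_of_adj {G : SimpleGraph V} {Γ : Finset V} {h : ℝ} (hh : 0 ≤ h)
    {f : V → ℝ} (hf : ∀ x, 0 ≤ f x) (g : V → ℝ) {x y : V} (hxy : G.Adj x y)
    (hreach : ∃ z ∈ Γ, ∃ N : ℕ, ∃ p : ℕ → V, IsGraphPath G N p y z) :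
    valueFun G Γ h f g x ≤ h * f x + valueFun G Γ h f g y := by
  suffices valueFun G Γ h f g x - h * f x ≤ valueFun G Γ h f g y by linarith
  refine le_valueFun hreach fun z hz N p hp => ?_
  have hle := valueFun_le_pathCost hh hf g hz (hp.cons hxy)
  rw [pathCost_succ] at hle
  exact sub_le_iff_le_add'.mpr hle

theorem exists_adj_add_le_valueFun [Finite V] {G : SimpleGraph V} {Γ : Finset V} {h : ℝ}
    (hh : 0 ≤ h) {f : V → ℝ} (hf : ∀ x, 0 ≤ f x) (g : V → ℝ) {x : V} (hx : x ∉ Γ)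
    (hnb : ∃ y, G.Adj x y)
    (hreach : ∃ z ∈ Γ, ∃ N : ℕ, ∃ p : ℕ → V, IsGraphPath G N p x z) :
    ∃ y, G.Adj x y ∧ h * f x + valueFun G Γ h f g y ≤ valueFun G Γ h f g x := by
  obtain ⟨y, hxy, hmin⟩ := Set.exists_min_image {y | G.Adj x y} (valueFun G Γ h f g)
    (Set.toFinite _) hnb
  refine ⟨y, hxy, le_valueFun hreach fun z hz N p hp => ?_⟩
  cases N with
  | zero => exact absurd (hp.1.symm.trans hp.2.1 ▸ hz) hx
  | succ N =>
    have hadj : G.Adj x (p 1) := by simpa [hp.1] using hp.2.2 0 N.succ_pos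
    have hle := valueFun_le_pathCost hh hf g hz hp.tail
    rw [pathCost_succ, hp.1]
    linarith [hmin (p 1) hadj]

/-- Existence via the value function: under nonnegativity of `f` and
reachability of the boundary, the value function `U` solves the discrete
eikonal equation `|DU|ₕ = f` at every interior vertex. -/
theorem valueFun_solves_discrete_eikonal [Fintype V] [Nonempty V]
    (G : SimpleGraph V) (Γ : Finset V) (hΓ : Γ.Nonempty)
    (hnb : ∀ x ∉ Γ, ∃ y, G.Adj x y)
    (h : ℝ) (hh : 0 < h)
    (f : V → ℝ) (hf0 : ∀ x ∉ Γ, 0 < f x) (hf : ∀ x, 0 ≤ f x)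
    (hreach : ∀ x : V, ∃ y ∈ Γ, ∃ N : ℕ, ∃ p : ℕ → V, IsGraphPath G N p x y)
    (g : V → ℝ) :
    ∀ x ∉ Γ, discGrad G h (valueFun G Γ h f g) x = f x := by
  intro x hx
  obtain ⟨y, hxy, hy⟩ := exists_adj_add_le_valueFun hh.le hf g hx (hnb x hx) (hreach x)
  refine IsGreatest.csSup_eq ⟨⟨y, hxy, ?_⟩, ?_⟩
  · have hle := valueFun_le_add_of_adj hh.le hf g hxy (hreach y)
    rw [div_eq_iff hh.ne']
    linarith
  · rintro _ ⟨z, hz, rfl⟩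
    have hle := valueFun_le_add_of_adj hh.le hf g hz (hreach z)
    rw [div_le_iff₀ hh]
    linarith
end

section
/- (A priori bound for solutions.) Assume G is connected and let d_Γ(x) := min_{y ∈ Γ} dist_G(x, y), where dist_G is the graph distance. Let g : Γ → ℝ and let u be a solution of the discrete eikonal equation |Du|ₕ = f on V₀ with u = g on Γ. Then for every x ∈ V, |u(x)| ≤ max_{y ∈ Γ} |g(y)| + h·d_Γ(x)·max_{z ∈ V} f(z). -/
open Finset

variable {V : Type*}

/-- On a finite graph, each difference quotient is at most the discrete gradient. -/
theorem sub_le_mul_discGrad [Finite V] {G : SimpleGraph V} {h : ℝ} (hh : 0 < h) (u : V → ℝ)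
    {x y : V} (hxy : G.Adj x y) : u x - u y ≤ h * discGrad G h u x := by
  have hle : (u x - u y) / h ≤ discGrad G h u x :=
    le_csSup ((Set.toFinite _).image _).bddAbove ⟨y, hxy, rfl⟩
  rwa [div_le_iff₀' hh] at hle

/-- On a finite graph, the discrete gradient is attained at a neighbour. -/
theorem exists_adj_sub_eq_mul_discGrad [Finite V] {G : SimpleGraph V} {h : ℝ} (hh : 0 < h)
    (u : V → ℝ) {x : V} (hx : ∃ y, G.Adj x y) :
    ∃ y, G.Adj x y ∧ u x - u y = h * discGrad G h u x := by
  obtain ⟨z, hz⟩ := hx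
  obtain ⟨y, hy, hy'⟩ :=
    (Set.Nonempty.image (fun y => (u x - u y) / h) (s := {y | G.Adj x y}) ⟨z, hz⟩).csSup_mem
      ((Set.toFinite _).image _)
  refine ⟨y, hy, ?_⟩
  rw [discGrad, ← hy']
  field_simp

/-- A subsolution with bounded slope grows at most linearly along walks ending in the boundary. -/
theorem le_add_mul_length_of_discGrad_le [Finite V] {G : SimpleGraph V} {Γ : Set V} {h : ℝ}
    (hh : 0 < h) {u : V → ℝ} {M F : ℝ} (hF : 0 ≤ F) (hM : ∀ x ∈ Γ, u x ≤ M)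
    (hu : ∀ x ∉ Γ, discGrad G h u x ≤ F) {x y : V} (p : G.Walk x y) (hy : y ∈ Γ) :
    u x ≤ M + h * p.length * F := by
  induction p with
  | nil => simpa using hM _ hy
  | @cons x z y hxz p ih =>
    by_cases hx : x ∈ Γ
    · exact (hM x hx).trans (le_add_of_nonneg_right (by positivity))
    · have hstep := sub_le_mul_discGrad hh u hxz
      have hslope := mul_le_mul_of_nonneg_left (hu x hx) hh.le
      rw [SimpleGraph.Walk.length_cons]
      push_cast
      linarith [ih hy]

/-- If the discrete gradient is positive off the boundary, lower bounds on the boundary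
are lower bounds everywhere. -/
theorem le_of_discGrad_pos [Finite V] {G : SimpleGraph V} {Γ : Set V}
    (hnb : ∀ x ∉ Γ, ∃ y, G.Adj x y) {h : ℝ} (hh : 0 < h) {u : V → ℝ} {m : ℝ}
    (hm : ∀ x ∈ Γ, m ≤ u x) (hu : ∀ x ∉ Γ, 0 < discGrad G h u x) (x : V) : m ≤ u x := by
  have : Nonempty V := ⟨x⟩
  obtain ⟨z, hz⟩ := Finite.exists_min u
  have hzΓ : z ∈ Γ := by
    by_contra hzΓ
    obtain ⟨y, -, hy⟩ := exists_adj_sub_eq_mul_discGrad hh u (hnb z hzΓ)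
    linarith [hz y, mul_pos hh (hu z hzΓ)]
  exact (hm z hzΓ).trans (hz x)

/-- A priori bound for solutions of the discrete Dirichlet problem:
`|u(x)| ≤ max_Γ |g| + h·d_Γ(x)·max_V f`, where `d_Γ` is the graph distance
from the boundary. -/
theorem discrete_a_priori_bound [Fintype V] [Nonempty V]
    (G : SimpleGraph V) (hc : G.Connected)
    (Γ : Finset V) (hΓ : Γ.Nonempty)
    (hnb : ∀ x ∉ Γ, ∃ y, G.Adj x y)
    (h : ℝ) (hh : 0 < h)
    (f : V → ℝ) (hf0 : ∀ x ∉ Γ, 0 < f x) (hf : ∀ x, 0 ≤ f x)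
    (g : V → ℝ)
    (u : V → ℝ)
    (hu : ∀ x ∉ Γ, discGrad G h u x = f x)
    (hbd : ∀ x ∈ Γ, u x = g x) :
    ∀ x : V, |u x| ≤ Γ.sup' hΓ (fun y => |g y|) +
      h * (Γ.inf' hΓ (fun y => G.dist x y) : ℝ) * univ.sup' univ_nonempty f := by
  intro x
  have hle : ∀ y ∈ Γ, |u y| ≤ Γ.sup' hΓ (fun y => |g y|) := fun y hy => by
    rw [hbd y hy]
    exact le_sup' (fun y => |g y|) hy
  have hmax : ∀ y, f y ≤ univ.sup' univ_nonempty f := fun y => le_sup' f (mem_univ y)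
  have hF : 0 ≤ univ.sup' univ_nonempty f := (hf x).trans (hmax x)
  obtain ⟨y, hy, hdist⟩ := Γ.exists_mem_eq_inf' hΓ (fun y => (G.dist x y : ℝ))
  obtain ⟨p, hp⟩ := hc.exists_walk_length_eq_dist x y
  rw [hdist, abs_le]
  constructor
  · have hlow := le_of_discGrad_pos (Γ := (Γ : Set V)) hnb hh
      (fun z hz => neg_le_of_abs_le (hle z hz)) (fun z hz => (hu z hz).symm ▸ hf0 z hz) x
    have hnonneg : 0 ≤ h * (G.dist x y : ℝ) * univ.sup' univ_nonempty f := by positivity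
    linarith
  · rw [← hp]
    exact le_add_mul_length_of_discGrad_le (Γ := (Γ : Set V)) hh hF
      (fun z hz => le_of_abs_le (hle z hz)) (fun z hz => (hu z hz).trans_le (hmax z)) p hy
end

section
/- (Barrier supersolution.) Assume G is connected and let d_Γ(x) := min_{y ∈ Γ} dist_G(x, y), where dist_G is the graph distance. Let g : Γ → ℝ and set M := max_{z ∈ V} f(z). Then the function u⁺(x) := max_{y ∈ Γ} |g(y)| + h·d_Γ(x)·M is a supersolution of the discrete eikonal equation |Du|ₕ = f on V₀ (i.e. max_{y ∼ x} (u⁺(x) − u⁺(y))/h ≥ f(x) for every x ∈ V₀) and satisfies u⁺ ≥ g on Γ. -/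
open Finset

variable {V : Type*}

/-- In a connected graph, every vertex distinct from `y` has a neighbour strictly closer to `y`. -/
theorem SimpleGraph.Connected.exists_adj_dist_add_one_le {G : SimpleGraph V} (hc : G.Connected)
    {x y : V} (hxy : x ≠ y) : ∃ z, G.Adj x z ∧ G.dist z y + 1 ≤ G.dist x y := by
  obtain ⟨p, hp⟩ := hc.exists_walk_length_eq_dist x y
  cases p with
  | nil => exact absurd rfl hxy
  | cons hadj q =>
    refine ⟨_, hadj, ?_⟩
    rw [← hp, SimpleGraph.Walk.length_cons]
    exact Nat.succ_le_succ (SimpleGraph.dist_le q)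

/-- On a finite vertex set, each difference quotient along an edge bounds `discGrad` from below. -/
theorem le_discGrad [Finite V] (G : SimpleGraph V) (h : ℝ) (u : V → ℝ) {x y : V}
    (hxy : G.Adj x y) : (u x - u y) / h ≤ discGrad G h u x :=
  le_csSup (Set.toFinite _).bddAbove (Set.mem_image_of_mem _ hxy)

/-- Barrier supersolution: `u⁺(x) = max_Γ |g| + h·d_Γ(x)·M`, with
`M = max_V f`, is a supersolution of `|Du|ₕ = f` on `V₀` and dominates `g`
on `Γ`. -/
theorem barrier_supersolution [Fintype V] [Nonempty V]
    (G : SimpleGraph V) (hc : G.Connected)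
    (Γ : Finset V) (hΓ : Γ.Nonempty)
    (hnb : ∀ x ∉ Γ, ∃ y, G.Adj x y)
    (h : ℝ) (hh : 0 < h)
    (f : V → ℝ) (hf0 : ∀ x ∉ Γ, 0 < f x) (hf : ∀ x, 0 ≤ f x)
    (g : V → ℝ) :
    (∀ x ∉ Γ, f x ≤ discGrad G h
      (fun z => Γ.sup' hΓ (fun y => |g y|) +
        h * (Γ.inf' hΓ (fun y => G.dist z y) : ℝ) * univ.sup' univ_nonempty f) x) ∧
    ∀ x ∈ Γ, g x ≤ Γ.sup' hΓ (fun y => |g y|) +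
        h * (Γ.inf' hΓ (fun y => G.dist x y) : ℝ) * univ.sup' univ_nonempty f := by
  have hM : ∀ x, f x ≤ univ.sup' univ_nonempty f := fun x => le_sup' f (mem_univ x)
  have hM0 : 0 ≤ univ.sup' univ_nonempty f :=
    (hf (Classical.arbitrary V)).trans (hM _)
  refine ⟨fun x hx => ?_, fun x hx => ?_⟩
  · obtain ⟨y, hy, hxy⟩ := exists_mem_eq_inf' hΓ (fun y => (G.dist x y : ℝ))
    obtain ⟨z, hxz, hz⟩ :=
      hc.exists_adj_dist_add_one_le (show x ≠ y from fun e => hx (e ▸ hy))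
    refine le_trans ?_ (le_discGrad G h _ hxz)
    have hzy : Γ.inf' hΓ (fun y => (G.dist z y : ℝ)) ≤ G.dist z y :=
      inf'_le (fun y => (G.dist z y : ℝ)) hy
    have hz' : (G.dist z y : ℝ) + 1 ≤ G.dist x y := by exact_mod_cast hz
    rw [le_div_iff₀ hh, add_sub_add_left_eq_sub, ← sub_mul, ← mul_sub]
    calc f x * h ≤ univ.sup' univ_nonempty f * h := by gcongr; exact hM x
      _ = h * 1 * univ.sup' univ_nonempty f := by ring
      _ ≤ _ := by
        gcongr
        linarith
  · have hd : 0 ≤ Γ.inf' hΓ (fun y => (G.dist x y : ℝ)) :=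
      le_inf' _ _ fun y _ => Nat.cast_nonneg _
    have hg : g x ≤ Γ.sup' hΓ (fun y => |g y|) :=
      (le_abs_self _).trans (le_sup' (fun y => |g y|) hx)
    exact hg.trans (le_add_of_nonneg_right (by positivity))
end

section
/- (Discrete Kruzhkov transform.) Let x ∈ V₀ and let u : V → ℝ satisfy max_{y ∼ x} (u(x) − u(y))/h = f(x). Define w : V → ℝ by w(z) := 1 − e^{−u(z)} and set f_h(x) := (e^{h·f(x)} − 1)/h. Then max_{y ∼ x} (w(x) − w(y))/h + f_h(x)·w(x) = f_h(x). -/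
open Finset

variable {V : Type*}

/-- On a finite graph the discrete gradient at a vertex with a neighbour is an attained maximum. -/
theorem isGreatest_discGrad [Finite V] (G : SimpleGraph V) (h : ℝ) (u : V → ℝ) {x : V}
    (hx : ∃ y, G.Adj x y) :
    IsGreatest ((fun y => (u x - u y) / h) '' {y | G.Adj x y}) (discGrad G h u x) :=
  have hfin := (Set.toFinite {y | G.Adj x y}).image fun y => (u x - u y) / h
  have hne : ((fun y => (u x - u y) / h) '' {y | G.Adj x y}).Nonempty := Set.Nonempty.image _ hx
  ⟨hne.csSup_mem hfin, fun _ ha => le_csSup hfin.bddAbove ha⟩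

/-- A monotone function acting on all difference quotients at a vertex acts on the discrete
gradient. -/
theorem discGrad_eq_of_monotone [Finite V] (G : SimpleGraph V) (h : ℝ) (u w : V → ℝ) {x : V}
    (hx : ∃ y, G.Adj x y) {φ : ℝ → ℝ} (hφ : Monotone φ)
    (hw : ∀ y, G.Adj x y → (w x - w y) / h = φ ((u x - u y) / h)) :
    discGrad G h w x = φ (discGrad G h u x) := by
  have hmax := hφ.map_isGreatest (isGreatest_discGrad G h u hx)
  rw [Set.image_image] at hmax
  exact (congrArg sSup (Set.image_congr hw)).trans hmax.csSup_eq

/-- Discrete Kruzhkov transform: if `max_{y ∼ x}(u(x) − u(y))/h = f(x)` at an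
interior vertex `x`, then `w = 1 − e^{−u}` satisfies
`max_{y ∼ x}(w(x) − w(y))/h + f_h(x)·w(x) = f_h(x)` with
`f_h(x) = (e^{h·f(x)} − 1)/h`. -/
theorem discrete_kruzhkov_transform [Fintype V] [Nonempty V]
    (G : SimpleGraph V) (Γ : Finset V) (hΓ : Γ.Nonempty)
    (hnb : ∀ z ∉ Γ, ∃ y, G.Adj z y)
    (h : ℝ) (hh : 0 < h)
    (f : V → ℝ) (hf0 : ∀ z ∉ Γ, 0 < f z)
    (x : V) (hx : x ∉ Γ)
    (u : V → ℝ) (hu : discGrad G h u x = f x)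
    (w : V → ℝ) (hw : ∀ z, w z = 1 - Real.exp (-u z)) :
    discGrad G h w x + (Real.exp (h * f x) - 1) / h * w x =
      (Real.exp (h * f x) - 1) / h := by
  have hmono : Monotone fun t => Real.exp (-u x) * ((Real.exp (h * t) - 1) / h) := by
    intro a b hab
    dsimp only
    gcongr
  have hquot : ∀ y, G.Adj x y →
      (w x - w y) / h = Real.exp (-u x) * ((Real.exp (h * ((u x - u y) / h)) - 1) / h) := by
    intro y _
    have hexp : Real.exp (-u y) = Real.exp (-u x) * Real.exp (u x - u y) := by
      rw [← Real.exp_add]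
      congr 1
      ring
    rw [hw, hw, mul_div_cancel₀ _ hh.ne', hexp]
    ring
  rw [discGrad_eq_of_monotone G h u w (hnb x hx) hmono hquot, hu, hw]
  ring
end
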